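/- Let N, b, Δ be positive integers with Δ dividing N, and let K ≥ 1 be a real number such that (2^b : ℝ) ≤ N / (K·Δ). Then there exists a finite set S of functions Fin N → (Fin b → Bool) such that: (1) |S| ≥ 2^(b·N − Δ) (entropy deficiency at most Δ); (2) for every subset J ⊆ Fin N and every α : Fin N → (Fin b → Bool), the number of y ∈ S with y i = α i for all i ∈ J is at most |S| · 2^(−(b−1)·|J|) (min-entropy rate at least 1 − 1/b); and (3) for every subset I ⊆ Fin N with (|I| : ℝ) ≤ (K−1)·Δ, for every x : Fin N → (Fin b → Bool) and every y ∈ S, there exists i ∉ I with IP_b(x i, y i) = false; that is, the projection of IP_b^N(x,y) to the coordinates outside I is never the all-one string. -/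

import Mathlib

def ff (n r k : ℕ) : ℕ := n.choose k * r ^ (n - k)

lemma ff_rec (n r k : ℕ) (h : k < n) : ff n r (k+1) * (k+1) * r = ff n r k * (n - k) := by
  unfold ff
  have h1 := Nat.choose_succ_right_eq n k
  have h2 : n - k = (n - (k+1)) + 1 := by omega
  calc _ = (n.choose (k+1) * (k+1)) * (r ^ (n-(k+1)) * r) := by ring
    _ = _ := by rw [h1, ← pow_succ, ← h2]; ring

lemma ff_le (n r m : ℕ) (hr : 1 ≤ r) (hn : (r + 1) * m ≤ n) :
    ∀ i t : ℕ, m = i + 1 + t → ff n r t ≤ ff n r (m + i) := by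
  obtain ⟨d, rfl⟩ : ∃ d, n = m + d := ⟨n - m, by have : m ≤ (r+1)*m := Nat.le_mul_of_pos_left _ (by omega)
                                                 omega⟩
  have hd : r * m ≤ d := by linarith
  have hmd : m ≤ d := le_trans (Nat.le_mul_of_pos_left _ hr) hd
  intro i
  induction i with
  | zero =>
    intro t ht
    have h := ff_rec (m+d) r t (by omega)
    have e : t + 1 = m := by omega
    have e2 : m + d - t = d + 1 := by omega
    rw [e, e2] at h
    rw [add_zero]
    have : ff (m+d) r t * (d+1) ≤ ff (m+d) r m * (d+1) := by
      rw [← h, mul_assoc]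
      exact Nat.mul_le_mul_left _ (by linarith)
    exact Nat.le_of_mul_le_mul_right this (by omega)
  | succ i ih =>
    intro t ht
    have h0 := ih (t+1) (by omega)
    have ha := ff_rec (m+d) r t (by omega)
    have hb := ff_rec (m+d) r (m+i) (by omega)
    obtain ⟨e, rfl⟩ : ∃ e, d = i + 1 + e := ⟨d - (i+1), by omega⟩
    have e2 : m + (i+1+e) - (m+i) = e+1 := by omega
    have e3 : m + (i+1+e) - t = 2*i+3+e := by omega
    rw [e3] at ha
    rw [e2] at hb
    rw [show m + (i+1) = m + i + 1 by ring]
    set A := ff (m+(i+1+e)) r t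
    set A0 := ff (m+(i+1+e)) r (t+1)
    set B := ff (m+(i+1+e)) r (m+i+1)
    set B0 := ff (m+(i+1+e)) r (m+i)
    have key : (m+i+1) * (t+1) * r^2 ≤ (2*i+3+e) * (e+1) := by
      have h1 : (r*m)^2 ≤ (i+1+e)^2 := Nat.pow_le_pow_left hd 2
      have h2 : (i+1)^2*1 ≤ (i+1)^2*r^2 := Nat.mul_le_mul_left _ (Nat.one_le_pow _ _ hr)
      subst ht
      zify at *
      nlinarith
    have : A * ((2*i+3+e) * (e+1)) ≤ B * ((2*i+3+e) * (e+1)) := by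
      calc A * ((2*i+3+e) * (e+1)) = (A * (2*i+3+e)) * (e+1) := by ring
        _ = A0 * ((t+1)*r*(e+1)) := by rw [← ha]; ring
        _ ≤ B0 * ((t+1)*r*(e+1)) := Nat.mul_le_mul_right _ h0
        _ = (B0 * (e+1)) * ((t+1)*r) := by ring
        _ = B * ((m+i+1) * (t+1) * r^2) := by rw [← hb]; ring
        _ ≤ _ := Nat.mul_le_mul_left _ key
    exact Nat.le_of_mul_le_mul_right this (by positivity)

lemma card_zeros {V : Type} [Fintype V] [DecidableEq V] (z : V) (N k : ℕ) :
    (Finset.univ.filter (fun y : Fin N → V =>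
      (Finset.univ.filter (fun i => y i = z)).card = k)).card = ff N (Fintype.card V - 1) k := by
  rw [Finset.card_eq_sum_card_fiberwise (f := fun y : Fin N → V => Finset.univ.filter (fun i => y i = z))
    (t := Finset.powersetCard k Finset.univ)]
  · rw [Finset.sum_congr rfl (g := fun _ => (Fintype.card V - 1)^(N-k))]
    · simp [ff]
    · intro A hA
      rw [Finset.mem_powersetCard] at hA
      have : (Finset.univ.filter (fun y : Fin N → V =>
          (Finset.univ.filter (fun i => y i = z)).card = k)).filter
          (fun y => Finset.univ.filter (fun i => y i = z) = A)
          = Fintype.piFinset (fun i => if i ∈ A then {z} else ({z}ᶜ : Finset V)) := by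
        ext y
        simp only [Finset.mem_filter, Finset.mem_univ, true_and, Fintype.mem_piFinset]
        constructor
        · rintro ⟨-, rfl⟩ i
          by_cases h : y i = z <;> simp [h]
        · intro h
          have : Finset.univ.filter (fun i => y i = z) = A := by
            ext i
            have := h i
            by_cases hi : i ∈ A <;> simp [hi] at this ⊢ <;> exact this
          exact ⟨by rw [this]; exact hA.2, this⟩
      rw [this, Fintype.card_piFinset]
      have : ∀ i, (if i ∈ A then {z} else ({z}ᶜ : Finset V)).card
          = if i ∈ A then 1 else (Fintype.card V - 1) := by
        intro i; split_ifs <;> simp [Finset.card_compl]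
      simp only [this, Finset.prod_ite, Finset.prod_const, one_pow, one_mul]
      congr 1
      have h3 : Finset.univ.filter (fun i => i ∉ A) = Aᶜ := by ext; simp
      rw [h3, Finset.card_compl, hA.2, Fintype.card_fin]
  · intro y hy
    simpa [Finset.mem_powersetCard] using hy

lemma half {V : Type} [Fintype V] [DecidableEq V] (z : V) (N m : ℕ) (hV : 2 ≤ Fintype.card V)
    (hN : Fintype.card V * m ≤ N) :
    Fintype.card V ^ N ≤ 2 * (Finset.univ.filter (fun y : Fin N → V =>
      m ≤ (Finset.univ.filter (fun i => y i = z)).card)).card := by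
  set Z : (Fin N → V) → ℕ := fun y => (Finset.univ.filter (fun i => y i = z)).card
  have hz : ∀ k, (Finset.univ.filter (fun y => Z y = k)).card = ff N (Fintype.card V - 1) k :=
    card_zeros z N
  have h1 : (Finset.univ.filter (fun y => ¬ m ≤ Z y)).card
      = ∑ t ∈ Finset.range m, ff N (Fintype.card V - 1) t := by
    rw [Finset.card_eq_sum_card_fiberwise (f := Z) (t := Finset.range m)]
    · refine Finset.sum_congr rfl fun t ht => ?_
      rw [← hz, Finset.filter_filter]
      congr 1; ext y; simp at ht ⊢; omega
    · intro y hy; simpa using hy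
  have h2 : ∑ i ∈ Finset.range m, ff N (Fintype.card V - 1) (m + i)
      ≤ (Finset.univ.filter (fun y => m ≤ Z y)).card := by
    have : ∑ i ∈ Finset.range m, ff N (Fintype.card V - 1) (m + i)
        = ((Finset.range m).biUnion (fun i => Finset.univ.filter (fun y => Z y = m + i))).card := by
      rw [Finset.card_biUnion]
      · simp only [hz]
      · intro i _ j _ hij
        refine Finset.disjoint_left.2 fun y => ?_
        simp; omega
    rw [this]
    apply Finset.card_le_card
    intro y; simp; omega
  have h3 : ∑ t ∈ Finset.range m, ff N (Fintype.card V - 1) t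
      ≤ ∑ i ∈ Finset.range m, ff N (Fintype.card V - 1) (m + i) := by
    rw [← Finset.sum_range_reflect]
    refine Finset.sum_le_sum fun i hi => ?_
    rw [Finset.mem_range] at hi
    refine ff_le N _ m (by omega) ?_ i _ (by omega)
    rwa [Nat.sub_add_cancel (by omega)]
  have h4 := Finset.card_filter_add_card_filter_not (s := (Finset.univ : Finset (Fin N → V))) (fun y => m ≤ Z y)
  have h5 : (Finset.univ : Finset (Fin N → V)).card = Fintype.card V ^ N := by simp
  change _ ≤ 2 * (Finset.univ.filter (fun y => m ≤ Z y)).card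
  omega

/-- The Inner-Product gadget: `IP_b(u,v)` is true iff the number of positions where
both `u` and `v` are true is odd. -/
def IP {b : ℕ} (u v : Fin b → Bool) : Bool :=
  (Finset.univ.filter (fun j => u j = true ∧ v j = true)).card % 2 == 1

/-- Counterexample for the Inner-Product gadget: a set `S` of Bob-inputs with
entropy deficiency at most `Δ`, min-entropy rate more than `1 - 1/b`, such that
for any small `I` the projection of `IP_b^N((\{0,1\}^b)^N, S)` outside `I` misses
the all-one string. -/
theorem stmt3 (N b Δ : ℕ) (hN : 0 < N) (hb : 0 < b) (hΔ : 0 < Δ) (hdvd : Δ ∣ N)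
    (K : ℝ) (hK : 1 ≤ K) (hsize : (2 : ℝ) ^ b ≤ (N : ℝ) / (K * Δ)) :
    ∃ S : Finset (Fin N → Fin b → Bool),
      -- (1) entropy deficiency at most Δ
      2 ^ (b * N - Δ) ≤ S.card ∧
      -- (2) min-entropy rate at least 1 - 1/b
      (∀ J : Finset (Fin N), ∀ α : Fin N → Fin b → Bool,
        (S.filter (fun y => ∀ i ∈ J, y i = α i)).card * 2 ^ ((b - 1) * J.card) ≤ S.card) ∧
      -- (3) outside any small I, the output is never all-one
      (∀ I : Finset (Fin N), (I.card : ℝ) ≤ (K - 1) * Δ →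
        ∀ x : Fin N → Fin b → Bool, ∀ y ∈ S, ∃ i, i ∉ I ∧ IP (x i) (y i) = false) := by
  classical
  have hV : Fintype.card (Fin b → Bool) = 2 ^ b := by simp
  have hΔR : (1:ℝ) ≤ Δ := by exact_mod_cast hΔ
  have hKΔ : 0 < K * Δ := by nlinarith
  have hM1 := Nat.floor_le hKΔ.le
  have hM2 := Nat.lt_floor_add_one (K * (Δ:ℝ))
  set M := ⌊K * (Δ:ℝ)⌋₊
  have hsz : 2 ^ b * M ≤ N := by
    rw [le_div_iff₀ hKΔ] at hsize
    have : (2:ℝ)^b * M ≤ N := le_trans (by gcongr) hsize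
    exact_mod_cast this
  have h2b : 2 ≤ 2 ^ b := by
    calc 2 = 2^1 := rfl
      _ ≤ 2^b := Nat.pow_le_pow_right (by norm_num) hb
  have hhalf := half (fun _ => false : Fin b → Bool) N M (by rw [hV]; exact h2b) (by rw [hV]; exact hsz)
  set S := Finset.univ.filter (fun y : Fin N → Fin b → Bool =>
      M ≤ (Finset.univ.filter (fun i => y i = fun _ => false)).card) with hS
  rw [hV, ← pow_mul] at hhalf
  have hbN : 1 ≤ b * N := Nat.mul_pos hb hN
  have hS1 : 2 ^ (b * N - 1) ≤ S.card := by
    have : 2 ^ (b*N) = 2 * 2 ^ (b*N-1) := by rw [← pow_succ']; congr 1; omega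
    omega
  refine ⟨S, le_trans (Nat.pow_le_pow_right (by norm_num) (by omega)) hS1, ?_, ?_⟩
  · intro J α
    rcases Finset.eq_empty_or_nonempty J with rfl | hJ
    · simp
    · have hJ1 : 1 ≤ J.card := hJ.card_pos
      have hJN : J.card ≤ N := by simpa using Finset.card_le_univ J
      have hc : (S.filter (fun y => ∀ i ∈ J, y i = α i)).card ≤ 2 ^ (b * (N - J.card)) := by
        have hsub : S.filter (fun y => ∀ i ∈ J, y i = α i)
            ⊆ Fintype.piFinset (fun i => if i ∈ J then {α i} else Finset.univ) := by
          intro y hy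
          rw [Finset.mem_filter] at hy
          rw [Fintype.mem_piFinset]
          intro i
          by_cases hi : i ∈ J
          · simp [hi, hy.2 i hi]
          · simp [hi]
        refine (Finset.card_le_card hsub).trans (le_of_eq ?_)
        rw [Fintype.card_piFinset]
        have : ∀ i, (if i ∈ J then {α i} else (Finset.univ : Finset (Fin b → Bool))).card
            = if i ∈ J then 1 else 2 ^ b := by
          intro i; split_ifs <;> simp
        simp only [this, Finset.prod_ite, Finset.prod_const, one_pow, one_mul]
        have h3 : Finset.univ.filter (fun i => i ∉ J) = Jᶜ := by ext; simp
        rw [h3, Finset.card_compl, Fintype.card_fin, pow_mul]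
      refine le_trans (Nat.mul_le_mul_right _ hc) (le_trans ?_ hS1)
      rw [← pow_add]
      apply Nat.pow_le_pow_right (by norm_num)
      obtain ⟨c, rfl⟩ : ∃ c, b = c + 1 := ⟨b - 1, by omega⟩
      obtain ⟨e, he⟩ : ∃ e, N = J.card + e := ⟨N - J.card, by omega⟩
      have e1 : N - J.card = e := by omega
      rw [e1, Nat.add_sub_cancel]
      apply Nat.le_sub_of_add_le
      calc _ ≤ (c+1)*e + c * J.card + J.card := by omega
        _ = (c+1) * (J.card + e) := by ring
        _ = _ := by rw [← he]
  · intro I hI x y hy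
    rw [hS, Finset.mem_filter] at hy
    have hlt : I.card < (Finset.univ.filter (fun i => y i = fun _ => false)).card := by
      refine lt_of_lt_of_le ?_ hy.2
      have : (I.card : ℝ) < M := by nlinarith
      exact_mod_cast this
    obtain ⟨i, hi, hiI⟩ := Finset.exists_mem_notMem_of_card_lt_card hlt
    refine ⟨i, hiI, ?_⟩
    rw [Finset.mem_filter] at hi
    rw [hi.2]
    simp [IP]
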